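/- arXiv:2509.20788 — 4 statements merged into one kernel-verified Lean document; each statement's English description precedes it below -/
import Mathlib

section
/- For every nonempty proper subset F ⊊ V with pinned set P = V∖F, the smallest eigenvalue λ = λ₁(L_F) lies in the open interval (0, min_{v∈F} d(v)) and satisfies the characteristic equation ∑_{v∈F} λ·d(v)/(d(v) − λ) = ∑_{v∈P} d(v); moreover, λ is the unique number in (0, min_{v∈F} d(v)) satisfying this equation. -/
open Finset

noncomputable def groundedLaplacian {V : Type*} [Fintype V] [DecidableEq V]
    (d : V → ℝ) (F : Finset V) : Matrix {v // v ∈ F} {v // v ∈ F} ℝ :=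
  fun u v => (if u = v then d u.1 else 0) - d u.1 * d v.1 / (∑ w, d w)

theorem groundedLaplacian_isHermitian {V : Type*} [Fintype V] [DecidableEq V]
    (d : V → ℝ) (F : Finset V) : (groundedLaplacian d F).IsHermitian := by
  ext u v
  rcases eq_or_ne u v with rfl | h
  · simp [groundedLaplacian, Matrix.conjTranspose_apply]
  · simp [groundedLaplacian, Matrix.conjTranspose_apply, h, Ne.symm h, mul_comm]

/-- Smallest eigenvalue of the grounded annealed Laplacian. -/
noncomputable def lambda1 {V : Type*} [Fintype V] [DecidableEq V]
    (d : V → ℝ) (F : Finset V) : ℝ :=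
  ⨅ i, (groundedLaplacian_isHermitian d F).eigenvalues i

theorem sum_sq_div_sub_strictMonoOn {V : Type*} {d : V → ℝ} (hd : ∀ v, 0 < d v)
    {F : Finset V} (hF : F.Nonempty) :
    StrictMonoOn (fun μ => ∑ v ∈ F, d v ^ 2 / (d v - μ)) (Set.Iio (F.inf' hF d)) := by
  intro a _ b hb hab
  refine Finset.sum_lt_sum_of_nonempty hF fun v hv => ?_
  have hbv : b < d v := lt_of_lt_of_le hb (Finset.inf'_le d hv)
  exact div_lt_div_of_pos_left (pow_pos (hd v) 2) (by linarith) (by linarith)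

theorem characteristic_eq_iff {V : Type*} [Fintype V] [DecidableEq V] (d : V → ℝ)
    {F : Finset V} (hF : F.Nonempty) {μ : ℝ} (hμ : μ < F.inf' hF d) :
    (∑ v ∈ F, μ * d v / (d v - μ)) = ∑ v ∈ Finset.univ \ F, d v ↔
      ∑ v ∈ F, d v ^ 2 / (d v - μ) = ∑ v, d v := by
  have h1 : ∑ v ∈ F, d v ^ 2 / (d v - μ) = ∑ v ∈ F, μ * d v / (d v - μ) + ∑ v ∈ F, d v := by
    rw [← Finset.sum_add_distrib]
    refine Finset.sum_congr rfl fun v hv => ?_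
    have : d v - μ ≠ 0 := by
      have := Finset.inf'_le d hv
      linarith
    field_simp
    ring
  have h2 := Finset.sum_sdiff (f := d) (Finset.subset_univ F)
  rw [h1, ← h2, add_left_inj]

theorem exists_sum_sq_div_sub_eq {V : Type*} [Fintype V] {d : V → ℝ}
    (hd : ∀ v, 0 < d v) {F : Finset V} (hF : F.Nonempty) (hFne : F ≠ Finset.univ) :
    ∃ μ, 0 < μ ∧ μ < F.inf' hF d ∧ ∑ v ∈ F, d v ^ 2 / (d v - μ) = ∑ v, d v := by
  obtain ⟨w, hw, hwm⟩ := Finset.exists_mem_eq_inf' hF d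
  have hwpos := hd w
  have hlt : ∑ v ∈ F, d v < ∑ v, d v := by
    obtain ⟨x, hx⟩ : ∃ x, x ∉ F := by
      by_contra! h
      exact hFne (Finset.eq_univ_of_forall h)
    exact Finset.sum_lt_sum_of_subset (Finset.subset_univ F) (Finset.mem_univ x) hx (hd x)
      fun v _ _ => (hd v).le
  have hwle : d w ≤ ∑ v ∈ F, d v := Finset.single_le_sum (fun v _ => (hd v).le) hw
  have hKpos : 0 < ∑ v, d v := by linarith
  set K := ∑ v, d v
  set b := d w - d w ^ 2 / K with hb
  have hb0 : 0 ≤ b := by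
    rw [hb, sub_nonneg, div_le_iff₀ hKpos]
    nlinarith
  have hbw : b < d w := by
    have : 0 < d w ^ 2 / K := by positivity
    linarith
  have hmin : ∀ v ∈ F, d w ≤ d v := fun v hv => hwm ▸ Finset.inf'_le d hv
  have hcont : ContinuousOn (fun μ => ∑ v ∈ F, d v ^ 2 / (d v - μ)) (Set.Icc 0 b) := by
    refine continuousOn_finsetSum F fun v hv => ?_
    refine continuousOn_const.div (by fun_prop) fun μ hμ => ?_
    have := hmin v hv
    have := hμ.2
    linarith
  have h0 : ∑ v ∈ F, d v ^ 2 / (d v - 0) = ∑ v ∈ F, d v := by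
    refine Finset.sum_congr rfl fun v _ => ?_
    have := (hd v).ne'
    rw [sub_zero]
    field_simp
  have hbK : K ≤ ∑ v ∈ F, d v ^ 2 / (d v - b) := by
    have heq : d w ^ 2 / (d w - b) = K := by
      rw [hb, sub_sub_cancel]
      field_simp
    refine heq.symm.le.trans (Finset.single_le_sum (f := fun v => d v ^ 2 / (d v - b)) ?_ hw)
    intro v hv
    have := hmin v hv
    exact div_nonneg (sq_nonneg _) (by linarith)
  obtain ⟨μ, hμ, hμK⟩ := intermediate_value_Icc hb0 hcont ⟨h0.le.trans hlt.le, hbK⟩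
  refine ⟨μ, lt_of_le_of_ne hμ.1 ?_, hwm ▸ hμ.2.trans_lt hbw, hμK⟩
  rintro rfl
  exact hlt.ne (h0.symm.trans hμK)

theorem groundedLaplacian_mulVec {V : Type*} [Fintype V] [DecidableEq V]
    (d : V → ℝ) (F : Finset V) (x : {v // v ∈ F} → ℝ) (u : {v // v ∈ F}) :
    (groundedLaplacian d F).mulVec x u =
      d u.1 * x u - d u.1 / (∑ w, d w) * ∑ v : {v // v ∈ F}, d v.1 * x v := by
  simp only [Matrix.mulVec, dotProduct, groundedLaplacian, sub_mul, Finset.sum_sub_distrib,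
    ite_mul, zero_mul, Finset.sum_ite_eq, Finset.mem_univ, if_true, Finset.mul_sum]
  congr 1
  exact Finset.sum_congr rfl fun v _ => by ring

/-- Below `min d`, the eigenvalues of the grounded Laplacian are exactly the roots of
`∑_{v∈F} d v ^ 2 / (d v - μ) = ∑_v d v`. -/
theorem mem_spectrum_groundedLaplacian_iff {V : Type*} [Fintype V] [DecidableEq V]
    {d : V → ℝ} (hd : ∀ v, 0 < d v) {F : Finset V} (hF : F.Nonempty) {μ : ℝ}
    (hμ : μ < F.inf' hF d) :
    μ ∈ spectrum ℝ (groundedLaplacian d F) ↔ ∑ v ∈ F, d v ^ 2 / (d v - μ) = ∑ v, d v := by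
  obtain ⟨w, hw⟩ := hF
  have hK : 0 < ∑ v, d v := Finset.sum_pos (fun v _ => hd v) ⟨w, Finset.mem_univ w⟩
  have hpos : ∀ v ∈ F, 0 < d v - μ := fun v hv => sub_pos.2 (hμ.trans_le (Finset.inf'_le d hv))
  rw [← Matrix.spectrum_toLin', ← Module.End.hasEigenvalue_iff_mem_spectrum]
  constructor
  · intro h
    obtain ⟨x, hx, hx0⟩ := h.exists_hasEigenvector
    rw [Module.End.mem_eigenspace_iff, Matrix.toLin'_apply] at hx
    set S := ∑ v : {v // v ∈ F}, d v.1 * x v with hS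
    have hxu : ∀ u : {v // v ∈ F}, x u = d u.1 / (d u.1 - μ) * (S / ∑ v, d v) := by
      intro u
      have h1 := congrFun hx u
      rw [groundedLaplacian_mulVec, Pi.smul_apply, smul_eq_mul, ← hS] at h1
      have := (hpos u.1 u.2).ne'
      field_simp at h1 ⊢
      linarith
    have hS0 : S ≠ 0 := by
      intro h
      refine hx0 (funext fun u => ?_)
      simp [hxu u, h]
    have hSS : S = (∑ v ∈ F, d v ^ 2 / (d v - μ)) * (S / ∑ v, d v) := by
      conv_lhs => rw [hS]
      rw [← Finset.sum_coe_sort F (fun v => d v ^ 2 / (d v - μ)), Finset.sum_mul]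
      refine Finset.sum_congr rfl fun u _ => ?_
      rw [hxu u]
      ring
    field_simp at hSS
    linarith
  · intro h
    refine Module.End.hasEigenvalue_of_hasEigenvector
      (x := fun u : {v // v ∈ F} => d u.1 / (d u.1 - μ)) ⟨?_, ?_⟩
    · rw [Module.End.mem_eigenspace_iff, Matrix.toLin'_apply]
      funext u
      have hsum : ∑ v : {v // v ∈ F}, d v.1 * (d v.1 / (d v.1 - μ)) = ∑ v, d v := by
        rw [← h, ← Finset.sum_coe_sort F (fun v => d v ^ 2 / (d v - μ))]
        exact Finset.sum_congr rfl fun v _ => by ring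
      rw [groundedLaplacian_mulVec, hsum, Pi.smul_apply, smul_eq_mul]
      have := (hpos u.1 u.2).ne'
      field_simp
      ring
    · intro h0
      exact (div_pos (hd w) (hpos w hw)).ne' (congrFun h0 ⟨w, hw⟩)

/-- for nonempty proper `F ⊊ V` with pinned set `P = V ∖ F`, the smallest
eigenvalue `λ = λ₁(L_F)` lies in `(0, min_{v∈F} d v)`, satisfies the characteristic equation
`∑_{v∈F} λ d v / (d v − λ) = ∑_{v∈P} d v`, and is the unique such number in that interval. -/
theorem stmt_2 {V : Type*} [Fintype V] [DecidableEq V] [Nonempty V]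
    (d : V → ℝ) (hd : ∀ v, 0 < d v)
    (F : Finset V) (hF : F.Nonempty) (hFne : F ≠ Finset.univ) :
    0 < lambda1 d F ∧ lambda1 d F < F.inf' hF d ∧
    (∑ v ∈ F, lambda1 d F * d v / (d v - lambda1 d F)) = ∑ v ∈ Finset.univ \ F, d v ∧
    ∀ μ : ℝ, 0 < μ → μ < F.inf' hF d →
      (∑ v ∈ F, μ * d v / (d v - μ)) = ∑ v ∈ Finset.univ \ F, d v → μ = lambda1 d F := by
  obtain ⟨μ, hμ0, hμm, hμ⟩ := exists_sum_sq_div_sub_eq hd hF hFne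
  have hH := groundedLaplacian_isHermitian d F
  have : Nonempty {v // v ∈ F} := hF.to_subtype
  have hmem := (mem_spectrum_groundedLaplacian_iff hd hF hμm).2 hμ
  rw [hH.spectrum_real_eq_range_eigenvalues] at hmem
  obtain ⟨i, hi⟩ := hmem
  have hle : lambda1 d F ≤ μ := hi ▸ ciInf_le (Set.finite_range _).bddBelow i
  have hlm := hle.trans_lt hμm
  obtain ⟨j, hj⟩ := exists_eq_ciInf_of_finite (f := hH.eigenvalues)
  have hl : lambda1 d F ∈ spectrum ℝ (groundedLaplacian d F) := by
    have := hH.eigenvalues_mem_spectrum_real j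
    rwa [hj] at this
  have hleq := (mem_spectrum_groundedLaplacian_iff hd hF hlm).1 hl
  have hinj := (sum_sq_div_sub_strictMonoOn hd hF).injOn
  have heq : lambda1 d F = μ := hinj hlm hμm (hleq.trans hμ.symm)
  refine ⟨heq ▸ hμ0, hlm, (characteristic_eq_iff d hF hlm).2 hleq, fun ν _ hνm hν => ?_⟩
  exact hinj hνm hlm (((characteristic_eq_iff d hF hνm).1 hν).trans hleq.symm)
end

section
/- Let P ⊆ V with |P| = c, 1 ≤ c < |V|, and F = V∖P. Suppose that for some index k all nodes of degree d̂_k belong to P, and that there exist f, f' ∈ F with d(f') < d̂_k < d(f). Then P is not globally optimal: there exists P' ⊆ V with |P'| = c and λ₁(L_{V∖P'}) > λ₁(L_{V∖P}). -/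
open Finset

/-- The k-th smallest distinct degree value (1-indexed); `dhat d 0 = 0` by convention. -/
noncomputable def dhat {V : Type*} [Fintype V] (d : V → ℝ) (k : ℕ) : ℝ :=
  if k = 0 then 0 else ((Finset.univ.image d).sort (· ≤ ·)).getD (k - 1) 0

/-- Multiplicity of the k-th smallest distinct degree value. -/
noncomputable def mult {V : Type*} [Fintype V] (d : V → ℝ) (k : ℕ) : ℕ :=
  (Finset.univ.filter fun v => d v = dhat d k).card

/-- Cumulative node count `α(k) = γ₁ + ⋯ + γ_k` (with `α(0) = 0`). -/
noncomputable def alphaCnt {V : Type*} [Fintype V] (d : V → ℝ) (k : ℕ) : ℕ :=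
  ∑ i ∈ Finset.Icc 1 k, mult d i

/-- The set of nodes of degree at most the k-th smallest distinct degree value. -/
noncomputable def lowSet {V : Type*} [Fintype V] (d : V → ℝ) (k : ℕ) : Finset V :=
  Finset.univ.filter fun v => d v ≤ dhat d k

/-- The secular function of the rank-one perturbation defining the grounded annealed Laplacian. -/
noncomputable def secular {V : Type*} (d : V → ℝ) (F : Finset V) (t : ℝ) : ℝ :=
  ∑ v ∈ F, d v ^ 2 / (d v - t)

theorem exists_eigenvector_lambda1 {V : Type*} [Fintype V] [DecidableEq V]
    (d : V → ℝ) {F : Finset V} (hF : F.Nonempty) :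
    ∃ x : {v // v ∈ F} → ℝ, x ≠ 0 ∧
      Matrix.mulVec (groundedLaplacian d F) x = lambda1 d F • x := by
  have : Nonempty {v // v ∈ F} := hF.to_subtype
  obtain ⟨i, hi⟩ := exists_eq_ciInf_of_finite
    (f := (groundedLaplacian_isHermitian d F).eigenvalues)
  refine ⟨(groundedLaplacian_isHermitian d F).eigenvectorBasis i, ?_, ?_⟩
  · intro h
    apply (groundedLaplacian_isHermitian d F).eigenvectorBasis.orthonormal.ne_zero i
    ext j
    exact congrFun h j
  · rw [Matrix.IsHermitian.mulVec_eigenvectorBasis, hi]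
    rfl

theorem posSemidef_groundedLaplacian_sub_lambda1 {V : Type*} [Fintype V] [DecidableEq V]
    (d : V → ℝ) (F : Finset V) :
    (groundedLaplacian d F - algebraMap ℝ _ (lambda1 d F)).PosSemidef := by
  have hH := groundedLaplacian_isHermitian d F
  rw [Matrix.posSemidef_iff_isHermitian_and_spectrum_nonneg]
  refine ⟨hH.sub ?_, ?_⟩
  · rw [Matrix.algebraMap_eq_diagonal]
    exact Matrix.isHermitian_diagonal _
  · intro a ha
    rw [← spectrum.sub_singleton_eq, hH.spectrum_real_eq_range_eigenvalues] at ha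
    obtain ⟨_, ⟨i, rfl⟩, _, rfl, rfl⟩ := ha
    exact sub_nonneg.2 (ciInf_le (Set.finite_range hH.eigenvalues).bddBelow i)

theorem lambda1_lt_apply {V : Type*} [Fintype V] [DecidableEq V]
    {d : V → ℝ} (hd : ∀ v, 0 < d v) {F : Finset V} {v : V} (hv : v ∈ F) :
    lambda1 d F < d v := by
  have h := (posSemidef_groundedLaplacian_sub_lambda1 d F).diag_nonneg (i := ⟨v, hv⟩)
  have hK : 0 < ∑ w, d w := Finset.sum_pos (fun w _ => hd w) ⟨v, Finset.mem_univ v⟩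
  have : 0 < d v * d v / ∑ w, d w := div_pos (mul_pos (hd v) (hd v)) hK
  simp only [Matrix.sub_apply, Matrix.algebraMap_matrix_apply, groundedLaplacian, if_true,
    Algebra.algebraMap_self, RingHom.id_apply] at h
  linarith

theorem secular_lambda1 {V : Type*} [Fintype V] [DecidableEq V]
    {d : V → ℝ} (hd : ∀ v, 0 < d v) {F : Finset V} (hF : F.Nonempty) :
    secular d F (lambda1 d F) = ∑ w, d w := by
  obtain ⟨x, hx0, hx⟩ := exists_eigenvector_lambda1 d hF
  set t := lambda1 d F
  set K := ∑ w, d w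
  have hK : 0 < K := Finset.sum_pos (fun w _ => hd w) (hF.mono (Finset.subset_univ F))
  set S := ∑ u : {v // v ∈ F}, d u.1 * x u with hS
  have hpos : ∀ u : {v // v ∈ F}, 0 < d u.1 - t := fun u => sub_pos.2 (lambda1_lt_apply hd u.2)
  have hcoord : ∀ u : {v // v ∈ F}, x u = d u.1 / (d u.1 - t) * (S / K) := by
    intro u
    have h := congrFun hx u
    have hrow : Matrix.mulVec (groundedLaplacian d F) x u = d u.1 * x u - d u.1 * (S / K) := by
      simp only [Matrix.mulVec, dotProduct, groundedLaplacian, sub_mul, ite_mul, zero_mul,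
        Finset.sum_sub_distrib, Finset.sum_ite_eq, Finset.mem_univ, if_true]
      rw [hS, Finset.sum_div, Finset.mul_sum]
      congr 1
      exact Finset.sum_congr rfl fun v _ => by ring
    rw [hrow, Pi.smul_apply, smul_eq_mul] at h
    have := (hpos u).ne'
    rw [div_mul_eq_mul_div, eq_div_iff this]
    linarith
  have hS0 : S ≠ 0 := by
    intro h
    apply hx0
    ext u
    rw [hcoord u, h]
    simp
  have hsum : S = secular d F t * (S / K) := by
    rw [secular, ← Finset.sum_coe_sort, Finset.sum_mul]
    conv_lhs => rw [hS]
    exact Finset.sum_congr rfl fun u _ => by rw [hcoord u]; ring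
  field_simp at hsum
  linarith

theorem secular_mono {V : Type*} {d : V → ℝ} {F : Finset V} {s t : ℝ}
    (hst : s ≤ t) (ht : ∀ v ∈ F, t < d v) : secular d F s ≤ secular d F t :=
  Finset.sum_le_sum fun v hv =>
    div_le_div_of_nonneg_left (sq_nonneg _) (sub_pos.2 (ht v hv)) (by linarith)

theorem lt_lambda1_of_secular_lt {V : Type*} [Fintype V] [DecidableEq V]
    {d : V → ℝ} (hd : ∀ v, 0 < d v) {F : Finset V} (hF : F.Nonempty) {t : ℝ}
    (ht : ∀ v ∈ F, t < d v) (hlt : secular d F t < ∑ w, d w) : t < lambda1 d F := by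
  by_contra! h
  have := secular_mono h ht
  rw [secular_lambda1 hd hF] at this
  linarith

theorem sq_div_sub_lt_or_lt {t a m b : ℝ} (hta : t < a) (ham : a < m) (hmb : m < b) :
    m ^ 2 / (m - t) < b ^ 2 / (b - t) ∨ m ^ 2 / (m - t) < a ^ 2 / (a - t) := by
  by_contra! h
  obtain ⟨h1, h2⟩ := h
  rw [div_le_div_iff₀ (by linarith) (by linarith)] at h1 h2
  have e1 : m * b ≤ t * (m + b) := by
    by_contra! hc
    nlinarith [mul_pos (sub_pos.2 hmb) (sub_pos.2 hc)]
  have e2 : t * (a + m) ≤ a * m := by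
    by_contra! hc
    nlinarith [mul_pos (sub_pos.2 ham) (sub_pos.2 hc)]
  nlinarith [mul_pos (sub_pos.2 (ham.trans hmb)) (sub_pos.2 (hta.trans ham))]

theorem lambda1_lt_lambda1_swap {V : Type*} [Fintype V] [DecidableEq V]
    {d : V → ℝ} (hd : ∀ v, 0 < d v) {F : Finset V} {f p : V} (hf : f ∈ F) (hp : p ∉ F)
    (hpt : lambda1 d F < d p)
    (h : d p ^ 2 / (d p - lambda1 d F) < d f ^ 2 / (d f - lambda1 d F)) :
    lambda1 d F < lambda1 d (insert p (F.erase f)) := by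
  refine lt_lambda1_of_secular_lt hd (Finset.insert_nonempty _ _) ?_ ?_
  · intro v hv
    rcases Finset.mem_insert.1 hv with rfl | hv
    · exact hpt
    · exact lambda1_lt_apply hd (Finset.mem_of_mem_erase hv)
  · rw [← secular_lambda1 hd ⟨f, hf⟩, secular, secular,
      Finset.sum_insert fun hm => hp (Finset.mem_of_mem_erase hm), ← Finset.add_sum_erase F _ hf]
    linarith

theorem exists_apply_eq_dhat {V : Type*} [Fintype V] (d : V → ℝ) {k : ℕ} (hk1 : 1 ≤ k)
    (hkQ : k ≤ (Finset.univ.image d).card) : ∃ v, d v = dhat d k := by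
  have hlen : k - 1 < ((Finset.univ.image d).sort (· ≤ ·)).length := by
    rw [Finset.length_sort]
    omega
  have hmem : dhat d k ∈ (Finset.univ.image d).sort (· ≤ ·) := by
    rw [dhat, if_neg (by omega), List.getD_eq_getElem _ _ hlen]
    exact List.getElem_mem hlen
  rw [Finset.mem_sort] at hmem
  simpa using hmem

/-- let `|P| = c` with `1 ≤ c < |V|` and `F = V ∖ P`. Suppose for some index
`k` (with `1 ≤ k ≤ Q`) all nodes of degree `d̂_k` belong to `P`, and there exist
`f, f' ∈ F` with `d f' < d̂_k < d f`. Then `P` is not globally optimal. -/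
theorem stmt_11 {V : Type*} [Fintype V] [DecidableEq V] [Nonempty V]
    (d : V → ℝ) (hd : ∀ v, 0 < d v)
    (c : ℕ) (hc1 : 1 ≤ c) (hcV : c < Fintype.card V)
    (P : Finset V) (hPcard : P.card = c)
    (k : ℕ) (hk1 : 1 ≤ k) (hkQ : k ≤ (Finset.univ.image d).card)
    (hall : ∀ v, d v = dhat d k → v ∈ P)
    (f f' : V) (hf : f ∉ P) (hf' : f' ∉ P)
    (hlow : d f' < dhat d k) (hhigh : dhat d k < d f) :
    ∃ P' : Finset V, P'.card = c ∧
      lambda1 d (Finset.univ \ P) < lambda1 d (Finset.univ \ P') := by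
  obtain ⟨p, hpk⟩ := exists_apply_eq_dhat d hk1 hkQ
  have hp := hall p hpk
  rw [← hpk] at hlow hhigh
  have hlt : lambda1 d (univ \ P) < d f' := lambda1_lt_apply hd (by simpa using hf')
  have hswap : ∀ g, g ∉ P →
      d p ^ 2 / (d p - lambda1 d (univ \ P)) < d g ^ 2 / (d g - lambda1 d (univ \ P)) →
      ∃ P' : Finset V, P'.card = c ∧ lambda1 d (univ \ P) < lambda1 d (univ \ P') := by
    intro g hg h
    refine ⟨insert g (P.erase p), ?_, ?_⟩
    · rw [Finset.card_insert_of_notMem fun hm => hg (Finset.mem_of_mem_erase hm),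
        Finset.card_erase_add_one hp, hPcard]
    · have hset : univ \ insert g (P.erase p) = insert p ((univ \ P).erase g) := by
        have hgp : p ≠ g := fun e => hg (e ▸ hp)
        ext v
        by_cases hv : v = p <;> simp [hv, hgp]
      rw [hset]
      refine lambda1_lt_lambda1_swap hd (by simpa using hg) (by simpa using hp) ?_ h
      exact hlt.trans hlow
  rcases sq_div_sub_lt_or_lt hlt hlow hhigh with h | h
  · exact hswap f hf h
  · exact hswap f' hf' h
end

section
/- Suppose |V| ≥ 2, the minimum of d is attained at a unique node (γ₁ = 1), and the budget is c = 1. Then for every globally optimal singleton pinned set P = {v}, either d(v) = max_{w∈V} d(w) (v is a highest-degree node) or v is the unique node of minimum degree d̂₁. -/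
open Finset

/-- The smallest eigenvalue of a real symmetric matrix is at most each diagonal entry. -/
theorem Matrix.IsHermitian.iInf_eigenvalues_le_diag {n : Type*} [Fintype n] [DecidableEq n]
    {A : Matrix n n ℝ} (hA : A.IsHermitian) (i : n) : ⨅ j, hA.eigenvalues j ≤ A i i := by
  have hU : (1 : Matrix n n ℝ) i i =
      ∑ j, (hA.eigenvectorUnitary : Matrix n n ℝ) i j ^ 2 := by
    rw [← Unitary.coe_mul_star_self hA.eigenvectorUnitary, Matrix.mul_apply]
    simp [Matrix.star_apply, sq]
  have hdiag : A i i =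
      ∑ j, hA.eigenvalues j * (hA.eigenvectorUnitary : Matrix n n ℝ) i j ^ 2 := by
    conv_lhs => rw [hA.spectral_theorem]
    rw [Unitary.conjStarAlgAut_apply, Matrix.mul_apply]
    refine Finset.sum_congr rfl fun j _ => ?_
    simp [Matrix.mul_diagonal, Matrix.star_apply]
    ring
  rw [hdiag, ← mul_one (⨅ j, hA.eigenvalues j), ← Matrix.one_apply_eq (α := ℝ) i, hU,
    Finset.mul_sum]
  gcongr with j
  exact ciInf_le (Set.finite_range _).bddBelow j

theorem lambda1_lt_degree {V : Type*} [Fintype V] [DecidableEq V] {d : V → ℝ}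
    (hd : ∀ v, 0 < d v) {F : Finset V} {u : V} (hu : u ∈ F) : lambda1 d F < d u := by
  have hle := (groundedLaplacian_isHermitian d F).iInf_eigenvalues_le_diag ⟨u, hu⟩
  have hK : 0 < ∑ w, d w := Finset.sum_pos (fun w _ => hd w) ⟨u, Finset.mem_univ u⟩
  have hpos : 0 < d u * d u / ∑ w, d w := div_pos (mul_pos (hd u) (hd u)) hK
  simp only [groundedLaplacian, if_true] at hle
  unfold lambda1
  linarith

/-- The secular equation satisfied by the smallest eigenvalue. -/
theorem sum_sq_div_sub_lambda1 {V : Type*} [Fintype V] [DecidableEq V] {d : V → ℝ}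
    (hd : ∀ v, 0 < d v) {F : Finset V} (hF : F.Nonempty) :
    ∑ u ∈ F, d u ^ 2 / (d u - lambda1 d F) = ∑ w, d w := by
  have : Nonempty {v // v ∈ F} := hF.to_subtype
  have hK : 0 < ∑ w, d w :=
    Finset.sum_pos (fun w _ => hd w) (hF.mono (Finset.subset_univ F))
  set hA := groundedLaplacian_isHermitian d F
  obtain ⟨j, hj⟩ := exists_eq_ciInf_of_finite (f := hA.eigenvalues)
  have hj' : hA.eigenvalues j = lambda1 d F := hj
  set x : {v // v ∈ F} → ℝ := ⇑(hA.eigenvectorBasis j) with hx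
  have hx0 : x ≠ 0 := by
    intro h
    refine hA.eigenvectorBasis.orthonormal.ne_zero j ?_
    ext i
    exact congrFun h i
  set s := ∑ u, d u.1 * x u with hs
  set K := ∑ w, d w with hKdef
  have heig (u : {v // v ∈ F}) : d u.1 * x u - d u.1 * s / K = lambda1 d F * x u := by
    have h := congrFun (hA.mulVec_eigenvectorBasis j) u
    rw [hj'] at h
    simp only [Matrix.mulVec, dotProduct, groundedLaplacian, sub_mul, Finset.sum_sub_distrib,
      ite_mul, zero_mul, Finset.sum_ite_eq, Finset.mem_univ, if_true, Pi.smul_apply,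
      smul_eq_mul] at h
    rw [← hx] at h
    rw [← h, hs, Finset.mul_sum, Finset.sum_div]
    congr 1
    refine Finset.sum_congr rfl fun w _ => ?_
    ring
  have hpos (u : {v // v ∈ F}) : 0 < d u.1 - lambda1 d F :=
    sub_pos.2 (lambda1_lt_degree hd u.2)
  have hxu (u : {v // v ∈ F}) : x u = d u.1 * s / K / (d u.1 - lambda1 d F) := by
    rw [eq_div_iff (hpos u).ne']
    linarith [heig u]
  have hs0 : s ≠ 0 := by
    intro h
    refine hx0 (funext fun u => ?_)
    rw [hxu u, h]
    simp
  have hsum : s = s / K * ∑ u : {v // v ∈ F}, d u.1 ^ 2 / (d u.1 - lambda1 d F) := by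
    rw [Finset.mul_sum]
    conv_lhs => rw [hs]
    refine Finset.sum_congr rfl fun u _ => ?_
    rw [hxu u]
    ring
  rw [← Finset.sum_coe_sort F (fun u => d u ^ 2 / (d u - lambda1 d F))]
  field_simp at hsum
  linarith

/-- The function `t ↦ t² / (t - l)` has no interior weak maximum to the right of its pole. -/
theorem sq_div_sub_lt_or_lt_s14 {l a b c : ℝ} (hla : l < a) (hab : a < b) (hbc : b < c) :
    b ^ 2 / (b - l) < a ^ 2 / (a - l) ∨ b ^ 2 / (b - l) < c ^ 2 / (c - l) := by
  have ha : 0 < a - l := by linarith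
  have hb : 0 < b - l := by linarith
  have hc : 0 < c - l := by linarith
  by_contra! h
  obtain ⟨h₁, h₂⟩ := h
  rw [div_le_div_iff₀ ha hb] at h₁
  rw [div_le_div_iff₀ hc hb] at h₂
  have h₃ : l ^ 2 ≤ (b - l) * (a - l) := by
    refine le_of_mul_le_mul_left ?_ (sub_pos.2 hab)
    linarith
  have h₄ : (c - l) * (b - l) ≤ l ^ 2 := by
    refine le_of_mul_le_mul_left ?_ (sub_pos.2 hbc)
    linarith
  nlinarith [mul_pos hb (sub_pos.2 (hab.trans hbc))]

/-- Pinning `w` instead of `v` raises the smallest eigenvalue when `w` has the larger secular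
term, provided the eigenvalue for `v` lies below `d v`. -/
theorem lambda1_sdiff_lt_of_sq_div_lt {V : Type*} [Fintype V] [DecidableEq V] {d : V → ℝ}
    (hd : ∀ v, 0 < d v) {v w : V} (hvw : v ≠ w) (hlt : lambda1 d (univ \ {v}) < d v)
    (h : d v ^ 2 / (d v - lambda1 d (univ \ {v})) < d w ^ 2 / (d w - lambda1 d (univ \ {v}))) :
    lambda1 d (univ \ {v}) < lambda1 d (univ \ {w}) := by
  have hw := sum_sq_div_sub_lambda1 hd (F := univ \ {w}) ⟨v, by simp [hvw]⟩
  have hv := sum_sq_div_sub_lambda1 hd (F := univ \ {v}) ⟨w, by simp [hvw.symm]⟩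
  set l := lambda1 d (univ \ {v}) with hl
  by_contra! hle
  have hpos (u : V) : 0 < d u - l := by
    rcases eq_or_ne u v with rfl | hu
    · exact sub_pos.2 hlt
    · exact sub_pos.2 (lambda1_lt_degree hd (by simp [hu]))
  have hmono : ∑ u ∈ univ \ {w}, d u ^ 2 / (d u - lambda1 d (univ \ {w})) ≤
      ∑ u ∈ univ \ {w}, d u ^ 2 / (d u - l) := by
    gcongr with u
    exact hpos u
  have hsv := Finset.sum_sdiff (f := fun u => d u ^ 2 / (d u - l)) (Finset.subset_univ {v})
  have hsw := Finset.sum_sdiff (f := fun u => d u ^ 2 / (d u - l)) (Finset.subset_univ {w})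
  rw [Finset.sum_singleton] at hsv hsw
  linarith

theorem dhat_one_le {V : Type*} [Fintype V] (d : V → ℝ) (v : V) : dhat d 1 ≤ d v := by
  have hne : (univ.image d).Nonempty := ⟨d v, by simp⟩
  have hlen : 0 < ((univ.image d).sort (· ≤ ·)).length := by
    rw [Finset.length_sort]
    exact hne.card_pos
  simp only [dhat, one_ne_zero, if_false, Nat.sub_self]
  rw [List.getD_eq_getElem _ _ hlen, Finset.sorted_zero_eq_min']
  exact Finset.min'_le _ _ (by simp)

/-- suppose `|V| ≥ 2`, the minimum of `d` is attained at a unique node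
(`γ₁ = 1`), and the budget is `c = 1`. Then for every globally optimal singleton pinned set
`P = {v}`, either `v` is a highest-degree node or `v` is the unique node of minimum degree
`d̂₁`. -/
theorem stmt_14 {V : Type*} [Fintype V] [DecidableEq V] [Nonempty V]
    (d : V → ℝ) (hd : ∀ v, 0 < d v)
    (hV : 2 ≤ Fintype.card V)
    (hγ1 : mult d 1 = 1)
    (v : V)
    (hopt : ∀ P' : Finset V, P'.card = 1 →
      lambda1 d (Finset.univ \ P') ≤ lambda1 d (Finset.univ \ {v})) :
    d v = Finset.univ.sup' Finset.univ_nonempty d ∨ d v = dhat d 1 := by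
  by_contra! hne
  obtain ⟨hmax, hmin⟩ := hne
  obtain ⟨M, -, hM⟩ := Finset.exists_mem_eq_sup' univ_nonempty d
  obtain ⟨m, hm⟩ := Finset.card_pos.1 (hγ1.symm.le : 0 < mult d 1)
  have hm' : d m = dhat d 1 := by simpa using hm
  have hmv : d m < d v := hm' ▸ lt_of_le_of_ne (dhat_one_le d v) hmin.symm
  have hvM : d v < d M := hM ▸ lt_of_le_of_ne (Finset.le_sup' d (mem_univ v)) hmax
  have hlm : lambda1 d (univ \ {v}) < d m :=
    lambda1_lt_degree hd (by simpa using fun h : m = v => hmv.ne (congrArg d h))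
  rcases sq_div_sub_lt_or_lt_s14 hlm hmv hvM with h | h
  · exact (lambda1_sdiff_lt_of_sq_div_lt hd (fun e => hmv.ne' (congrArg d e))
      (hlm.trans hmv) h).not_ge (hopt {m} (card_singleton m))
  · exact (lambda1_sdiff_lt_of_sq_div_lt hd (fun e => hvM.ne (congrArg d e))
      (hlm.trans hmv) h).not_ge (hopt {M} (card_singleton M))
end

section
/- (Threshold monotonicity) Let 1 ≤ c and c + 1 < |V|, and let 1 ≤ k ≤ Q with α(k) ≤ c. If some globally optimal pinned set of size c contains every node of degree at most d̂_k, then every globally optimal pinned set of size c + 1 also contains every node of degree at most d̂_k. -/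
open Finset

theorem Matrix.IsHermitian.posSemidef_sub_iInf_eigenvalues {n : Type*} [Fintype n]
    [DecidableEq n] {A : Matrix n n ℝ} (hA : A.IsHermitian) :
    (A - algebraMap ℝ (Matrix n n ℝ) (⨅ i, hA.eigenvalues i)).PosSemidef := by
  refine Matrix.posSemidef_iff_isHermitian_and_spectrum_nonneg.2 ⟨?_, ?_⟩
  · refine hA.sub ?_
    rw [Matrix.algebraMap_eq_diagonal]
    exact Matrix.isHermitian_diagonal _
  · rw [← spectrum.sub_singleton_eq, hA.spectrum_real_eq_range_eigenvalues]
    rintro _ ⟨_, ⟨i, rfl⟩, _, rfl, rfl⟩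
    exact sub_nonneg.2 (ciInf_le (f := hA.eigenvalues) (Set.finite_range _).bddBelow i)

section GroundedLaplacian

variable {V : Type*} [Fintype V] [DecidableEq V] {d : V → ℝ} {F : Finset V} {t : ℝ}

theorem groundedLaplacian_dotProduct_mulVec (d : V → ℝ) (F : Finset V) (x : {v // v ∈ F} → ℝ) :
    dotProduct x ((groundedLaplacian d F).mulVec x) =
      ∑ v, d v.1 * x v ^ 2 - (∑ v, d v.1 * x v) ^ 2 / ∑ w, d w := by
  have h : ∀ u, (groundedLaplacian d F).mulVec x u =
      d u.1 * x u - d u.1 / (∑ w, d w) * ∑ v, d v.1 * x v := by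
    intro u
    simp only [Matrix.mulVec, dotProduct, groundedLaplacian, sub_mul, Finset.sum_sub_distrib,
      ite_mul, zero_mul, Finset.sum_ite_eq, Finset.mem_univ, if_true, Finset.mul_sum]
    congr 1
    exact Finset.sum_congr rfl fun v _ => by ring
  simp only [dotProduct, h, mul_sub, Finset.sum_sub_distrib]
  congr 1
  · exact Finset.sum_congr rfl fun v _ => by ring
  · rw [sq, Finset.sum_mul, Finset.sum_div]
    exact Finset.sum_congr rfl fun v _ => by ring

theorem lambda1_mul_sum_sq_le (d : V → ℝ) (F : Finset V) (x : {v // v ∈ F} → ℝ) :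
    lambda1 d F * ∑ v, x v ^ 2 ≤
      ∑ v, d v.1 * x v ^ 2 - (∑ v, d v.1 * x v) ^ 2 / ∑ w, d w := by
  have h := (groundedLaplacian_isHermitian d F).posSemidef_sub_iInf_eigenvalues
    |>.dotProduct_mulVec_nonneg x
  rw [Matrix.sub_mulVec, dotProduct_sub, star_trivial, groundedLaplacian_dotProduct_mulVec,
    Algebra.algebraMap_eq_smul_one, Matrix.smul_mulVec, Matrix.one_mulVec, dotProduct_smul,
    smul_eq_mul, sub_nonneg] at h
  simpa only [lambda1, dotProduct, sq] using h

theorem exists_groundedLaplacian_eigenvector (d : V → ℝ) (hF : F.Nonempty) :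
    ∃ x : {v // v ∈ F} → ℝ, x ≠ 0 ∧ lambda1 d F * ∑ v, x v ^ 2 =
      ∑ v, d v.1 * x v ^ 2 - (∑ v, d v.1 * x v) ^ 2 / ∑ w, d w := by
  have : Nonempty {v // v ∈ F} := hF.to_subtype
  set hA := groundedLaplacian_isHermitian d F
  obtain ⟨i, hi⟩ := exists_eq_ciInf_of_finite (f := hA.eigenvalues)
  refine ⟨hA.eigenvectorBasis i, fun h => ?_, ?_⟩
  · exact hA.eigenvectorBasis.orthonormal.ne_zero i (by ext j; exact congrFun h j)
  · rw [← groundedLaplacian_dotProduct_mulVec, hA.mulVec_eigenvectorBasis, dotProduct_smul, hi,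
      smul_eq_mul]
    simp only [lambda1, dotProduct, sq]

theorem lambda1_lt (hd : ∀ v, 0 < d v) {v : V} (hv : v ∈ F) : lambda1 d F < d v := by
  have hK : 0 < ∑ w, d w := Finset.sum_pos (fun w _ => hd w) ⟨v, Finset.mem_univ v⟩
  have h := lambda1_mul_sum_sq_le d F (Pi.single ⟨v, hv⟩ 1)
  simp only [Pi.single_apply, ite_pow, one_pow, ne_eq, OfNat.ofNat_ne_zero, not_false_eq_true,
    zero_pow, mul_ite, mul_one, mul_zero, Finset.sum_ite_eq', Finset.mem_univ, if_true] at h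
  have : 0 < d v ^ 2 / ∑ w, d w := div_pos (pow_pos (hd v) 2) hK
  linarith

theorem sum_sq_div_sub_lambda1_le (hd : ∀ v, 0 < d v) (hF : F.Nonempty) :
    ∑ v ∈ F, d v ^ 2 / (d v - lambda1 d F) ≤ ∑ w, d w := by
  have hpos : ∀ v ∈ F, 0 < d v - lambda1 d F := fun v hv => sub_pos.2 (lambda1_lt hd hv)
  have hS : 0 < ∑ v ∈ F, d v ^ 2 / (d v - lambda1 d F) :=
    Finset.sum_pos (fun v hv => div_pos (pow_pos (hd v) 2) (hpos v hv)) hF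
  have hK : 0 < ∑ w, d w :=
    Finset.sum_pos (fun w _ => hd w) (hF.mono (Finset.subset_univ F))
  have h := lambda1_mul_sum_sq_le d F fun v => d v.1 / (d v.1 - lambda1 d F)
  have h₁ : ∑ v : {v // v ∈ F}, d v.1 * (d v.1 / (d v.1 - lambda1 d F)) =
      ∑ v ∈ F, d v ^ 2 / (d v - lambda1 d F) := by
    rw [← Finset.sum_coe_sort F]
    exact Finset.sum_congr rfl fun v _ => by ring
  have h₂ : ∑ v : {v // v ∈ F}, d v.1 * (d v.1 / (d v.1 - lambda1 d F)) ^ 2 -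
      lambda1 d F * ∑ v : {v // v ∈ F}, (d v.1 / (d v.1 - lambda1 d F)) ^ 2 =
      ∑ v ∈ F, d v ^ 2 / (d v - lambda1 d F) := by
    rw [← Finset.sum_coe_sort F, Finset.mul_sum, ← Finset.sum_sub_distrib]
    refine Finset.sum_congr rfl fun v _ => ?_
    have := (hpos v.1 v.2).ne'
    field_simp
  rw [h₁] at h
  set S := ∑ v ∈ F, d v ^ 2 / (d v - lambda1 d F)
  have h₃ : S ^ 2 / ∑ w, d w ≤ S := by linarith
  rw [div_le_iff₀ hK, sq] at h₃
  exact le_of_mul_le_mul_left h₃ hS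

theorem lt_lambda1 (hF : F.Nonempty) (ht : ∀ v ∈ F, t < d v)
    (hS : ∑ v ∈ F, d v ^ 2 / (d v - t) < ∑ w, d w) : t < lambda1 d F := by
  by_contra! hle
  obtain ⟨x, hx, h⟩ := exists_groundedLaplacian_eigenvector d hF
  have hpos : ∀ v ∈ F, 0 < d v - t := fun v hv => sub_pos.2 (ht v hv)
  have hS₀ : 0 ≤ ∑ v ∈ F, d v ^ 2 / (d v - t) :=
    Finset.sum_nonneg fun v hv => div_nonneg (sq_nonneg _) (hpos v hv).le
  have hK : 0 < ∑ w, d w := hS₀.trans_lt hS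
  have hT : 0 < ∑ v : {v // v ∈ F}, (d v.1 - t) * x v ^ 2 := by
    obtain ⟨i, hi⟩ := Function.ne_iff.1 hx
    exact Finset.sum_pos' (fun v _ => mul_nonneg (hpos v.1 v.2).le (sq_nonneg _))
      ⟨i, Finset.mem_univ i, mul_pos (hpos i.1 i.2) (sq_pos_of_ne_zero hi)⟩
  have hCS : (∑ v : {v // v ∈ F}, d v.1 * x v) ^ 2 ≤
      (∑ v ∈ F, d v ^ 2 / (d v - t)) * ∑ v : {v // v ∈ F}, (d v.1 - t) * x v ^ 2 := by
    rw [← Finset.sum_coe_sort F]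
    refine Finset.sum_sq_le_sum_mul_sum_of_sq_le_mul _
      (fun v _ => div_nonneg (sq_nonneg _) (hpos v.1 v.2).le)
      (fun v _ => mul_nonneg (hpos v.1 v.2).le (sq_nonneg _)) fun v _ => le_of_eq ?_
    have := (hpos v.1 v.2).ne'
    field_simp
  have hsplit : ∑ v : {v // v ∈ F}, (d v.1 - t) * x v ^ 2 =
      ∑ v, d v.1 * x v ^ 2 - t * ∑ v, x v ^ 2 := by
    rw [Finset.mul_sum, ← Finset.sum_sub_distrib]
    exact Finset.sum_congr rfl fun v _ => sub_mul _ _ _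
  have hmono : lambda1 d F * ∑ v, x v ^ 2 ≤ t * ∑ v, x v ^ 2 :=
    mul_le_mul_of_nonneg_right hle (Finset.sum_nonneg fun v _ => sq_nonneg _)
  have hTle : ∑ v : {v // v ∈ F}, (d v.1 - t) * x v ^ 2 ≤
      (∑ v : {v // v ∈ F}, d v.1 * x v) ^ 2 / ∑ w, d w := by linarith
  rw [le_div_iff₀ hK] at hTle
  nlinarith

end GroundedLaplacian

theorem sq_div_sub_lt_of_sq_div_sub_le {x y s t : ℝ} (hx : 0 < x) (hxy : x < y) (hst : s < t)
    (htx : t < x) (h : y ^ 2 / (y - s) ≤ x ^ 2 / (x - s)) :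
    y ^ 2 / (y - t) < x ^ 2 / (x - t) := by
  rw [div_le_div_iff₀ (by linarith) (by linarith)] at h
  rw [div_lt_div_iff₀ (by linarith) (by linarith)]
  have : s * (y ^ 2 - x ^ 2) < t * (y ^ 2 - x ^ 2) :=
    mul_lt_mul_of_pos_right hst (by nlinarith)
  nlinarith

/-- Threshold monotonicity: let `1 ≤ c`, `c + 1 < |V|` and `1 ≤ k ≤ Q` with
`α(k) ≤ c`. If some globally optimal pinned set of size `c` contains every node of degree
at most `d̂_k`, then every globally optimal pinned set of size `c + 1` also contains every
node of degree at most `d̂_k`. -/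
theorem stmt_15 {V : Type*} [Fintype V] [DecidableEq V] [Nonempty V]
    (d : V → ℝ) (hd : ∀ v, 0 < d v)
    (c : ℕ) (hc1 : 1 ≤ c) (hcV : c + 1 < Fintype.card V)
    (k : ℕ) (hk1 : 1 ≤ k) (hkQ : k ≤ (Finset.univ.image d).card)
    (hαk : alphaCnt d k ≤ c)
    (P : Finset V) (hPcard : P.card = c)
    (hPopt : ∀ P' : Finset V, P'.card = c →
      lambda1 d (Finset.univ \ P') ≤ lambda1 d (Finset.univ \ P))
    (hPlow : ∀ v, d v ≤ dhat d k → v ∈ P) :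
    ∀ P₁ : Finset V, P₁.card = c + 1 →
      (∀ P' : Finset V, P'.card = c + 1 →
        lambda1 d (Finset.univ \ P') ≤ lambda1 d (Finset.univ \ P₁)) →
      ∀ v, d v ≤ dhat d k → v ∈ P₁ := by
  intro P₁ hP₁card hP₁opt v hv
  by_contra hvP₁
  have hcompl : ∀ G : Finset V, univ \ (univ \ G) = G := fun G => by simp
  have hcard : ∀ G : Finset V, (univ \ G).card = Fintype.card V - G.card := fun G => by
    rw [card_sdiff_of_subset (subset_univ G), card_univ]
  set F := univ \ P with hF
  set F₁ := univ \ P₁ with hF₁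
  have hFcard : F.card = Fintype.card V - c := by rw [hF, hcard, hPcard]
  have hF₁card : F₁.card = Fintype.card V - (c + 1) := by rw [hF₁, hcard, hP₁card]
  have hFopt : ∀ G : Finset V, G.card = F.card → lambda1 d G ≤ lambda1 d F := fun G hG => by
    have := hPopt (univ \ G) (by rw [hcard]; omega)
    rwa [hcompl] at this
  have hF₁opt : ∀ G : Finset V, G.card = F₁.card → lambda1 d G ≤ lambda1 d F₁ := fun G hG => by
    have := hP₁opt (univ \ G) (by rw [hcard]; omega)
    rwa [hcompl] at this
  have hFne : F.Nonempty := card_pos.1 (by omega)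
  have hF₁ne : F₁.Nonempty := card_pos.1 (by omega)
  have hvF₁ : v ∈ F₁ := by simp [hF₁, hvP₁]
  have hvF : v ∉ F := by simp [hF, hPlow v hv]
  obtain ⟨w, hwF, hwF₁⟩ : ∃ w ∈ F, w ∉ F₁ := exists_mem_notMem_of_card_lt_card (by omega)
  have hvw : d v < d w := by
    refine lt_of_le_of_lt hv (not_le.1 fun h => ?_)
    exact (mem_sdiff.1 hwF).2 (hPlow w h)
  have hterm : ∀ u ∈ F, 0 < d u ^ 2 / (d u - lambda1 d F) := fun u hu =>
    div_pos (pow_pos (hd u) 2) (sub_pos.2 (lambda1_lt hd hu))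
  have hlt : lambda1 d F < lambda1 d F₁ := by
    refine lt_of_lt_of_le (lt_lambda1 (F := F.erase w) (card_pos.1 ?_)
      (fun u hu => lambda1_lt hd (mem_of_mem_erase hu)) ?_) (hF₁opt (F.erase w) ?_)
    · rw [card_erase_of_mem hwF]; omega
    · have := sum_sq_div_sub_lambda1_le hd hFne
      rw [← add_sum_erase F _ hwF] at this
      linarith [hterm w hwF]
    · rw [card_erase_of_mem hwF]; omega
  have hv_lt : lambda1 d F₁ < d v := lambda1_lt hd hvF₁
  have hexch : d w ^ 2 / (d w - lambda1 d F) ≤ d v ^ 2 / (d v - lambda1 d F) := by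
    by_contra! hcon
    have hvE : v ∉ F.erase w := fun h => hvF (mem_of_mem_erase h)
    refine (hFopt (insert v (F.erase w)) ?_).not_gt (lt_lambda1 (insert_nonempty _ _) ?_ ?_)
    · rw [card_insert_of_notMem hvE, card_erase_of_mem hwF]; omega
    · intro u hu
      rcases mem_insert.1 hu with rfl | hu
      · exact hlt.trans hv_lt
      · exact lambda1_lt hd (mem_of_mem_erase hu)
    · rw [sum_insert hvE]
      have := sum_sq_div_sub_lambda1_le hd hFne
      rw [← add_sum_erase F _ hwF] at this
      linarith
  have hstrict := sq_div_sub_lt_of_sq_div_sub_le (hd v) hvw hlt hv_lt hexch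
  have hwE : w ∉ F₁.erase v := fun h => hwF₁ (mem_of_mem_erase h)
  refine (hF₁opt (insert w (F₁.erase v)) ?_).not_gt (lt_lambda1 (insert_nonempty _ _) ?_ ?_)
  · rw [card_insert_of_notMem hwE, card_erase_of_mem hvF₁]; omega
  · intro u hu
    rcases mem_insert.1 hu with rfl | hu
    · exact hv_lt.trans hvw
    · exact lambda1_lt hd (mem_of_mem_erase hu)
  · rw [sum_insert hwE]
    have := sum_sq_div_sub_lambda1_le hd hF₁ne
    rw [← add_sum_erase F₁ _ hvF₁] at this
    linarith
end
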